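/- arXiv:2503.15163 — 2 statements merged into one kernel-verified Lean document; each statement's English description precedes it below -/
import Mathlib

section
/- Let 𝒴 be a measurable space that carries at least two distinct probability measures. Let ρ : [0,∞) → [0,∞) be a function satisfying ρ(v) = 0 if and only if v = 0, and let 𝒟 : 𝒫(𝒴) × 𝒫(𝒴) → [0,∞) be any map satisfying the identity of indiscernibles, i.e. 𝒟(μ, ν) = 0 if and only if μ = ν. Then there exist probability measures μ₁⁰, μ₁¹, μ₂⁰, μ₂¹ on 𝒴 (namely any choice with μ₁⁰ = μ₂¹ ≠ μ₁¹ = μ₂⁰) and weights ν₁ = ν₂ = 1/2 such that ρ(𝒟(ν₁·μ₁⁰ + ν₂·μ₂⁰, ν₁·μ₁¹ + ν₂·μ₂¹)) ≠ ν₁·ρ(𝒟(μ₁⁰, μ₁¹)) + ν₂·ρ(𝒟(μ₂⁰, μ₂¹)). Consequently, no dissimilarity measure satisfying the identity of indiscernibles admits a client-wise decomposition of the fairness regularizer valid for all mixture weights and all client distributions. -/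
open MeasureTheory
open scoped ENNReal NNReal

/-- **Impossibility of client-wise decomposition of the fairness regularizer.**
If a measurable space `Y` carries at least two distinct probability measures, `ρ` vanishes
exactly at `0`, and `D` satisfies the identity of indiscernibles on probability measures,
then there exist probability measures `μ₁⁰ = μ₂¹ ≠ μ₁¹ = μ₂⁰` and weights `ν₁ = ν₂ = 1/2`
for which the decomposition identity fails. -/
theorem no_client_decomposition
    {Y : Type*} [MeasurableSpace Y]
    (hY : ∃ μ ν : Measure Y, IsProbabilityMeasure μ ∧ IsProbabilityMeasure ν ∧ μ ≠ ν)
    (ρ : NNReal → NNReal) (hρ : ∀ v, ρ v = 0 ↔ v = 0)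
    (D : Measure Y → Measure Y → NNReal)
    (hD : ∀ μ ν : Measure Y, IsProbabilityMeasure μ → IsProbabilityMeasure ν →
      (D μ ν = 0 ↔ μ = ν)) :
    ∃ μ₁₀ μ₁₁ μ₂₀ μ₂₁ : Measure Y,
      IsProbabilityMeasure μ₁₀ ∧ IsProbabilityMeasure μ₁₁ ∧
      IsProbabilityMeasure μ₂₀ ∧ IsProbabilityMeasure μ₂₁ ∧
      μ₁₀ = μ₂₁ ∧ μ₁₁ = μ₂₀ ∧ μ₁₀ ≠ μ₁₁ ∧
      ρ (D ((1/2 : ℝ≥0∞) • μ₁₀ + (1/2 : ℝ≥0∞) • μ₂₀)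
           ((1/2 : ℝ≥0∞) • μ₁₁ + (1/2 : ℝ≥0∞) • μ₂₁))
        ≠ (1/2 : NNReal) * ρ (D μ₁₀ μ₁₁) + (1/2 : NNReal) * ρ (D μ₂₀ μ₂₁) := by
  obtain ⟨μ, ν, hμ, hν, hne⟩ := hY
  refine ⟨μ, ν, ν, μ, hμ, hν, hν, hμ, rfl, rfl, hne, ?_⟩
  have hmix : IsProbabilityMeasure ((1/2 : ℝ≥0∞) • μ + (1/2 : ℝ≥0∞) • ν) :=
    ⟨by simp [ENNReal.inv_two_add_inv_two]⟩
  have hlhs : ρ (D ((1/2 : ℝ≥0∞) • μ + (1/2 : ℝ≥0∞) • ν)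
      ((1/2 : ℝ≥0∞) • ν + (1/2 : ℝ≥0∞) • μ)) = 0 := by
    rw [add_comm ((1/2 : ℝ≥0∞) • ν), hρ, hD _ _ hmix hmix]
  have hpos : 0 < ρ (D μ ν) := pos_iff_ne_zero.mpr fun h =>
    hne ((hD μ ν hμ hν).mp ((hρ _).mp h))
  rw [hlhs]
  exact ne_of_lt (by positivity)
end

section
/- Let H be a real inner product space, let K ≥ 2 and 1 ≤ S ≤ K be integers, let v₁, …, v_K ∈ H, and let v̄ = (1/K) Σ_{k=1}^K v_k. Averaging uniformly over all subsets 𝒮 ⊆ {1, …, K} of cardinality S, one has the exact identity (1/binom(K,S)) Σ_{𝒮 : |𝒮| = S} ‖(1/S) Σ_{k ∈ 𝒮} v_k − v̄‖² = ((K − S)/(S(K − 1))) · (1/K) Σ_{k=1}^K ‖v_k − v̄‖², and consequently the bound (1/binom(K,S)) Σ_{𝒮 : |𝒮| = S} ‖(1/S) Σ_{k ∈ 𝒮} v_k‖² ≤ 2‖v̄‖² + (1 − S/K) · (2/(S K)) Σ_{k=1}^K ‖v_k‖². -/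
open Finset

/-- The second moment of the sum of a family of vectors over a uniformly random subset of fixed
cardinality, with denominators cleared. -/
theorem sum_powersetCard_norm_sum_sq {ι H : Type*} [Fintype ι] [DecidableEq ι]
    [NormedAddCommGroup H] [InnerProductSpace ℝ H] (S : ℕ) (hS : 1 ≤ S)
    (hK : 2 ≤ Fintype.card ι) (w : ι → H) :
    (Fintype.card ι : ℝ) * ((Fintype.card ι : ℝ) - 1) *
        ∑ s ∈ powersetCard S (univ : Finset ι), ‖∑ k ∈ s, w k‖ ^ 2
      = ((Fintype.card ι).choose S : ℝ) * S *
        (((Fintype.card ι : ℝ) - S) * ∑ k, ‖w k‖ ^ 2 + ((S : ℝ) - 1) * ‖∑ k, w k‖ ^ 2) := by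
  have count (i j : ι) :
      (Fintype.card ι : ℝ) * ((Fintype.card ι : ℝ) - 1) *
        #{s ∈ powersetCard S (univ : Finset ι) | i ∈ s ∧ j ∈ s}
      = ((Fintype.card ι).choose S : ℝ) * S *
        ((if i = j then (Fintype.card ι : ℝ) - S else 0) + ((S : ℝ) - 1)) := by
    have hfilter : {s ∈ powersetCard S (univ : Finset ι) | i ∈ s ∧ j ∈ s}
        = {s ∈ powersetCard S (univ : Finset ι) | {i, j} ⊆ s} := by
      ext s; simp [insert_subset_iff]
    rw [hfilter]
    obtain ⟨n, hn⟩ : ∃ n, Fintype.card ι = n + 2 := ⟨_, (Nat.sub_add_cancel hK).symm⟩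
    obtain ⟨t, rfl⟩ : ∃ t, S = t + 1 := ⟨_, (Nat.sub_add_cancel hS).symm⟩
    have h₁ : ((n : ℝ) + 2) * ((n + 1).choose t : ℝ) = ((n + 2).choose (t + 1) : ℝ) * (t + 1) := by
      exact_mod_cast Nat.add_one_mul_choose_eq (n + 1) t
    rw [hn]
    push_cast
    rcases eq_or_ne i j with rfl | hij
    · rw [card_filter_powersetCard_subset _ _ _ (subset_univ _) (by simp)]
      simp only [pair_eq_singleton, card_singleton, card_univ, hn, Nat.add_sub_cancel, if_true]
      rw [show n + 2 - 1 = n + 1 by omega]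
      linear_combination ((n : ℝ) + 1) * h₁
    · simp only [hij, if_false]
      rcases t with _ | t
      · have : #{s ∈ powersetCard (0 + 1) (univ : Finset ι) | {i, j} ⊆ s} = 0 := by
          rw [card_eq_zero, filter_eq_empty_iff]
          intro s hs hsub
          have := card_le_card hsub
          rw [card_pair hij, (mem_powersetCard.1 hs).2] at this
          omega
        rw [this]
        simp
      · rw [card_filter_powersetCard_subset _ _ _ (subset_univ _) (by rw [card_pair hij]; omega)]
        rw [card_pair hij, card_univ, hn, Nat.add_sub_cancel, show t + 1 + 1 - 2 = t by omega]
        have h₂ : ((n : ℝ) + 1) * (n.choose t : ℝ) = ((n + 1).choose (t + 1) : ℝ) * (t + 1) := by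
          exact_mod_cast Nat.add_one_mul_choose_eq n t
        push_cast at h₁ ⊢
        linear_combination ((n : ℝ) + 2) * h₂ + ((t : ℝ) + 1) * h₁
  have expand (s : Finset ι) : ‖∑ k ∈ s, w k‖ ^ 2 = ∑ i ∈ s, ∑ j ∈ s, inner ℝ (w i) (w j) := by
    rw [← real_inner_self_eq_norm_sq, sum_inner]
    simp_rw [inner_sum]
  have hsum : ∑ s ∈ powersetCard S (univ : Finset ι), ‖∑ k ∈ s, w k‖ ^ 2
      = ∑ i, ∑ j, (#{s ∈ powersetCard S (univ : Finset ι) | i ∈ s ∧ j ∈ s} : ℝ)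
          * inner ℝ (w i) (w j) := by
    have (s : Finset ι) : ‖∑ k ∈ s, w k‖ ^ 2
        = ∑ i, ∑ j, if i ∈ s ∧ j ∈ s then inner ℝ (w i) (w j) else 0 := by
      simp [expand, ite_and]
    simp_rw [this]
    rw [sum_comm]
    refine sum_congr rfl fun i _ => ?_
    rw [sum_comm]
    refine sum_congr rfl fun j _ => ?_
    rw [← sum_filter, sum_const, nsmul_eq_mul]
  rw [hsum, expand univ]
  simp_rw [mul_sum, ← mul_assoc, count, mul_add, add_mul, sum_add_distrib]
  simp [mul_sum, mul_assoc]

/-- **Sampling-without-replacement variance identity and bound.**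
For `v₁, …, v_K` in a real inner product space with mean `v̄`, averaging over all subsets
`𝒮` of cardinality `S`, one has
`(1/C(K,S)) Σ_𝒮 ‖(1/S) Σ_{k∈𝒮} v_k − v̄‖² = ((K−S)/(S(K−1))) (1/K) Σ_k ‖v_k − v̄‖²`, and
consequently
`(1/C(K,S)) Σ_𝒮 ‖(1/S) Σ_{k∈𝒮} v_k‖² ≤ 2‖v̄‖² + (1 − S/K)(2/(SK)) Σ_k ‖v_k‖²`. -/
theorem subset_sampling_variance
    {H : Type*} [NormedAddCommGroup H] [InnerProductSpace ℝ H]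
    (K S : ℕ) (hK : 2 ≤ K) (hS : 1 ≤ S) (hSK : S ≤ K)
    (v : Fin K → H) :
    (1 / (K.choose S : ℝ)) *
        ∑ 𝒮 ∈ Finset.powersetCard S (Finset.univ : Finset (Fin K)),
          ‖(1 / (S : ℝ)) • (∑ k ∈ 𝒮, v k) - (1 / (K : ℝ)) • (∑ k, v k)‖ ^ 2
      = (((K : ℝ) - S) / (S * ((K : ℝ) - 1))) *
          ((1 / (K : ℝ)) * ∑ k, ‖v k - (1 / (K : ℝ)) • (∑ k', v k')‖ ^ 2) ∧
    (1 / (K.choose S : ℝ)) *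
        ∑ 𝒮 ∈ Finset.powersetCard S (Finset.univ : Finset (Fin K)),
          ‖(1 / (S : ℝ)) • (∑ k ∈ 𝒮, v k)‖ ^ 2
      ≤ 2 * ‖(1 / (K : ℝ)) • (∑ k, v k)‖ ^ 2
        + (1 - (S : ℝ) / K) * (2 / ((S : ℝ) * K)) * ∑ k, ‖v k‖ ^ 2 := by
  have hK' : (2 : ℝ) ≤ K := by exact_mod_cast hK
  have hS' : (1 : ℝ) ≤ S := by exact_mod_cast hS
  have hSK' : (S : ℝ) ≤ K := by exact_mod_cast hSK
  have hC : (0 : ℝ) < K.choose S := by exact_mod_cast Nat.choose_pos hSK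
  have hK₀ : (0 : ℝ) < K := by linarith
  have hS₀ : (0 : ℝ) < S := by linarith
  have hK₁ : (0 : ℝ) < (K : ℝ) - 1 := by linarith
  have moment (w : Fin K → H) : (1 / (K.choose S : ℝ)) *
        ∑ s ∈ powersetCard S (univ : Finset (Fin K)), ‖(1 / (S : ℝ)) • ∑ k ∈ s, w k‖ ^ 2
      = (((K : ℝ) - S) * ∑ k, ‖w k‖ ^ 2 + ((S : ℝ) - 1) * ‖∑ k, w k‖ ^ 2)
        / (S * K * ((K : ℝ) - 1)) := by
    have h := sum_powersetCard_norm_sum_sq S hS (by simpa using hK) w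
    rw [Fintype.card_fin] at h
    simp_rw [norm_smul, mul_pow, ← mul_sum, Real.norm_eq_abs, sq_abs]
    field_simp
    linear_combination h
  constructor
  · set c := (1 / (K : ℝ)) • ∑ k, v k with hc
    have hzero : ∑ k, (v k - c) = 0 := by
      rw [sum_sub_distrib, sum_const, card_univ, Fintype.card_fin, ← Nat.cast_smul_eq_nsmul ℝ, hc,
        smul_smul, mul_one_div_cancel hK₀.ne', one_smul, sub_self]
    have hcenter : ∀ s ∈ powersetCard S (univ : Finset (Fin K)),
        ‖(1 / (S : ℝ)) • (∑ k ∈ s, v k) - c‖ ^ 2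
          = ‖(1 / (S : ℝ)) • ∑ k ∈ s, (v k - c)‖ ^ 2 := by
      intro s hs
      rw [sum_sub_distrib, sum_const, (mem_powersetCard.1 hs).2, ← Nat.cast_smul_eq_nsmul ℝ,
        smul_sub, smul_smul, one_div_mul_cancel hS₀.ne', one_smul]
    rw [sum_congr rfl hcenter, moment, hzero, norm_zero]
    field_simp
    ring
  · rw [moment, norm_smul, mul_pow, Real.norm_eq_abs, sq_abs]
    have hQ : 0 ≤ ∑ k, ‖v k‖ ^ 2 := sum_nonneg fun k _ => sq_nonneg _
    have hM : 0 ≤ ‖∑ k, v k‖ ^ 2 := sq_nonneg _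
    generalize ∑ k, ‖v k‖ ^ 2 = Q at hQ ⊢
    generalize ‖∑ k, v k‖ ^ 2 = M at hM ⊢
    have hdiff : 2 * ((1 / (K : ℝ)) ^ 2 * M) + (1 - (S : ℝ) / K) * (2 / ((S : ℝ) * K)) * Q
        - (((K : ℝ) - S) * Q + ((S : ℝ) - 1) * M) / (S * K * ((K : ℝ) - 1))
        = ((S * (K - 2) + K) * M + (K - S) * (K - 2) * Q) / (S * K ^ 2 * ((K : ℝ) - 1)) := by
      field_simp
      ring
    have hK₂ : (0 : ℝ) ≤ (K : ℝ) - 2 := by linarith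
    have hKS : (0 : ℝ) ≤ (K : ℝ) - S := by linarith
    rw [← sub_nonneg, hdiff]
    positivity
end
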